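/- Suppose d ≥ 2 is even. Then the following two families of complex measures on ℝ coincide: (i) for every Φ ∈ 𝒮(ℝ^d) there exists Φ₂ ∈ 𝒮(ℝ²) such that, setting h(ξ) = ∫_{ℝ∖{0}} Φ₂(a, ξ/a) |a|^{(d−2)/2} da/|a| (an integral converging absolutely for every ξ ≠ 0 and defining a locally integrable function on ℝ), one has ∫_{ℝ^d} g(q_d(x)) Φ(x) dx = ∫_ℝ g(ξ) h(ξ) dξ for every continuous compactly supported g : ℝ → ℂ; and (ii) conversely, for every Φ₂ ∈ 𝒮(ℝ²) there exists Φ ∈ 𝒮(ℝ^d) for which the same identity holds with h defined by the same formula. -/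

import Mathlib

open MeasureTheory Filter

noncomputable section

/-- Extension of a vector in `ℝ^d` by zeros, for convenient indexing. -/
def padR {d : ℕ} (x : Fin d → ℝ) (n : ℕ) : ℝ :=
  if h : n < d then x ⟨n, h⟩ else 0

/-- The split quadratic form `q_d` on `ℝ^d`:
`x₁x₂ + x₃x₄ + ⋯ + x_{d−1}x_d` for `d` even, and
`x₁² + x₂x₃ + ⋯ + x_{d−1}x_d` for `d` odd. -/
def splitQR (d : ℕ) (x : Fin d → ℝ) : ℝ :=
  if Even d then ∑ i ∈ Finset.range (d / 2), padR x (2 * i) * padR x (2 * i + 1)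
  else padR x 0 ^ 2 + ∑ i ∈ Finset.range (d / 2), padR x (2 * i + 1) * padR x (2 * i + 2)

/-- The twisted pushforward
`h(ξ) = ∫_{ℝ∖{0}} Φ₂(a, ξ/a) |a|^{(d−2)/2} da/|a|`. -/
def hTwoR (d : ℕ) (Φ₂ : SchwartzMap (ℝ × ℝ) ℂ) (ξ : ℝ) : ℂ :=
  ∫ a in ({0}ᶜ : Set ℝ), Φ₂ (a, ξ / a) * ((|a| ^ (((d : ℝ) - 2) / 2) / |a| : ℝ) : ℂ)

open scoped SchwartzMap ContDiff FourierTransform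
open Complex (I)

section TQ
variable {E : Type*} [NormedAddCommGroup E] [InnerProductSpace ℝ E] [FiniteDimensional ℝ E]
  [MeasurableSpace E] [BorelSpace E]

set_option linter.unusedSectionVars false

lemma haar_prod : (volume : Measure (E × E)).IsAddHaarMeasure :=
  Measure.prod.instIsAddHaarMeasure (volume : Measure E) (volume : Measure E)

lemma temp_prod : (volume : Measure (E × E)).HasTemperateGrowth := by
  have := haar_prod (E := E)
  infer_instance

/-- Twisted characteristic function of the pushforward. -/
def tQ (j : ℕ) (Φ : SchwartzMap (E × E) ℂ) (τ : ℝ) : ℂ :=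
  ∫ z : E × E, Complex.exp (((-2 * Real.pi * (τ * inner ℝ z.1 z.2) : ℝ) : ℂ) * I) *
    (((‖z.1‖ ^ j : ℝ) : ℂ) * Φ z)

lemma integrable_wt (j : ℕ) (Φ : SchwartzMap (E × E) ℂ) :
    Integrable (fun z : E × E => ((‖z.1‖ ^ j : ℝ) : ℂ) * Φ z) := by
  have := temp_prod (E := E)
  have h := Φ.integrable_pow_mul (volume : Measure (E × E)) j
  refine h.mono' (by
    have := Φ.continuous
    exact Continuous.aestronglyMeasurable (by fun_prop)) ?_
  refine Eventually.of_forall fun z => ?_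
  rw [norm_mul, Complex.norm_real, norm_pow, norm_norm]
  gcongr
  exact norm_fst_le z

lemma norm_expI (r : ℝ) : ‖Complex.exp ((r : ℂ) * I)‖ = 1 := Complex.norm_exp_ofReal_mul_I r

lemma integrable_exp_mul {α : Type*} [TopologicalSpace α] [MeasurableSpace α] [OpensMeasurableSpace α]
    {μ : Measure α} {f : α → ℂ} (hf : Integrable f μ) {r : α → ℝ} (hr : Continuous r) :
    Integrable (fun z => Complex.exp ((r z : ℂ) * I) * f z) μ := by
  refine hf.bdd_mul (c := 1) ?_ ?_
  · exact Continuous.aestronglyMeasurable (by fun_prop)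
  · exact Eventually.of_forall fun z => (norm_expI _).le

lemma temperate_inner : Function.HasTemperateGrowth
    (fun z : E × E => ((-2 * Real.pi * inner ℝ z.1 z.2 : ℝ) : ℂ) * I) := by
  have h1 : Function.HasTemperateGrowth (fun z : E × E => (inner ℝ z.1 z.2 : ℝ)) := by
    have := ContinuousLinearMap.bilinear_hasTemperateGrowth (𝕜 := ℝ) (innerSL ℝ (E := E))
      (f := fun z : E × E => z.1) (g := fun z : E × E => z.2)
      (ContinuousLinearMap.fst ℝ E E).hasTemperateGrowth
      (ContinuousLinearMap.snd ℝ E E).hasTemperateGrowth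
    exact this
  have h2 : Function.HasTemperateGrowth (fun z : E × E => (-2 * Real.pi * inner ℝ z.1 z.2 : ℝ)) :=
    (Function.HasTemperateGrowth.const _).mul h1
  exact (Function.HasTemperateGrowth.comp Complex.ofRealCLM.hasTemperateGrowth h2).mul (Function.HasTemperateGrowth.const _)

/-- multiplication by `-2πi⟨x,y⟩`. -/
def mulQ (Φ : SchwartzMap (E × E) ℂ) : SchwartzMap (E × E) ℂ :=
  SchwartzMap.smulLeftCLM ℂ
    (fun z : E × E => ((-2 * Real.pi * inner ℝ z.1 z.2 : ℝ) : ℂ) * I) Φ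

lemma mulQ_apply (Φ : SchwartzMap (E × E) ℂ) (z : E × E) :
    mulQ Φ z = (((-2 * Real.pi * inner ℝ z.1 z.2 : ℝ) : ℂ) * I) * Φ z := by
  rw [mulQ, SchwartzMap.smulLeftCLM_apply_apply temperate_inner, smul_eq_mul]

lemma hasDerivAt_tQ (j : ℕ) (Φ : SchwartzMap (E × E) ℂ) (τ : ℝ) :
    HasDerivAt (tQ j Φ) (tQ j (mulQ Φ) τ) τ := by
  unfold tQ
  refine (hasDerivAt_integral_of_dominated_loc_of_deriv_le (𝕜 := ℝ) (μ := (volume : Measure (E × E))) (x₀ := τ)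
    (F := fun (t : ℝ) (z : E × E) => Complex.exp (((-2 * Real.pi * (t * inner ℝ z.1 z.2) : ℝ) : ℂ) * I) *
    (((‖z.1‖ ^ j : ℝ) : ℂ) * Φ z))
    (F' := fun (t : ℝ) (z : E × E) => Complex.exp (((-2 * Real.pi * (t * inner ℝ z.1 z.2) : ℝ) : ℂ) * I) *
    (((‖z.1‖ ^ j : ℝ) : ℂ) * mulQ Φ z)) (s := Set.univ)
    (bound := fun z => ‖((‖z.1‖ ^ j : ℝ) : ℂ) * mulQ Φ z‖) Filter.univ_mem ?_ ?_ ?_ ?_ ?_ ?_).2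
  · refine Eventually.of_forall fun t => ?_
    exact (integrable_exp_mul (integrable_wt j Φ) (by fun_prop)).aestronglyMeasurable
  · exact integrable_exp_mul (integrable_wt j Φ) (by fun_prop)
  · exact (integrable_exp_mul (integrable_wt j _) (by fun_prop)).aestronglyMeasurable
  · refine Eventually.of_forall fun z t _ => ?_
    rw [norm_mul, norm_expI, one_mul]
  · exact (integrable_wt j _).norm
  · refine Eventually.of_forall fun z t _ => ?_
    have h0 : HasDerivAt (fun t : ℝ => (((-2 * Real.pi * (t * inner ℝ z.1 z.2) : ℝ) : ℂ) * I))
        (((-2 * Real.pi * inner ℝ z.1 z.2 : ℝ) : ℂ) * I) t := by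
      have h1 : HasDerivAt (fun t : ℝ => (-2 * Real.pi * (t * inner ℝ z.1 z.2) : ℝ))
          (-2 * Real.pi * inner ℝ z.1 z.2) t := by
        simpa using ((hasDerivAt_id t).mul_const (inner ℝ z.1 z.2)).const_mul (-2 * Real.pi)
      exact h1.ofReal_comp.mul_const I
    have := (h0.cexp).mul_const (((‖z.1‖ ^ j : ℝ) : ℂ) * Φ z)
    refine this.congr_deriv ?_
    rw [mulQ_apply]; ring

lemma contDiff_tQ (j : ℕ) (Φ : SchwartzMap (E × E) ℂ) : ContDiff ℝ ∞ (tQ j Φ) := by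
  rw [contDiff_infty]
  intro n
  induction n generalizing Φ with
  | zero =>
    exact contDiff_zero.2 (continuous_iff_continuousAt.2 fun τ => (hasDerivAt_tQ j Φ τ).continuousAt)
  | succ n ih =>
    have : ((n + 1 : ℕ) : WithTop ℕ∞) = (n : WithTop ℕ∞) + 1 := by norm_cast
    rw [this, contDiff_succ_iff_deriv]
    refine ⟨fun τ => (hasDerivAt_tQ j Φ τ).differentiableAt, by simp, ?_⟩
    have : deriv (tQ j Φ) = tQ j (mulQ Φ) := funext fun τ => (hasDerivAt_tQ j Φ τ).deriv
    rw [this]; exact ih _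

/-- tensor product of Schwartz functions -/
def tens (f U : SchwartzMap E ℂ) : SchwartzMap (E × E) ℂ where
  toFun z := f z.1 * U z.2
  smooth' := ((f.smooth ⊤).comp contDiff_fst).mul ((U.smooth ⊤).comp contDiff_snd)
  decay' := by
    intro k n
    let F : SchwartzMap E ℂ → ℕ → ℕ → ℝ := fun g k i => SchwartzMap.seminorm ℝ k i g
    refine ⟨∑ i ∈ Finset.range (n + 1), (n.choose i : ℝ) *
      (F f k i * F U 0 (n - i) + F f 0 i * F U k (n - i)), fun z => ?_⟩
    have hf : ContDiff ℝ ∞ (fun z : E × E => f z.1) := (f.smooth ⊤).comp contDiff_fst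
    have hU : ContDiff ℝ ∞ (fun z : E × E => U z.2) := (U.smooth ⊤).comp contDiff_snd
    have h1 := norm_iteratedFDeriv_mul_le hf hU z (n := n) (by exact_mod_cast le_top)
    have hfst : ∀ i, ‖iteratedFDeriv ℝ i (fun z : E × E => f z.1) z‖ ≤
        ‖iteratedFDeriv ℝ i f z.1‖ := by
      intro i
      have := (ContinuousLinearMap.fst ℝ E E).iteratedFDeriv_comp_right (f.smooth ⊤) z
        (i := i) (by exact_mod_cast le_top)
      have e : (⇑f ∘ ⇑(ContinuousLinearMap.fst ℝ E E)) = (fun z : E × E => f z.1) := rfl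
      rw [e] at this
      rw [this]
      refine (ContinuousMultilinearMap.norm_compContinuousLinearMap_le _ _).trans ?_
      refine mul_le_of_le_one_right (norm_nonneg _) ?_
      exact Finset.prod_le_one (fun _ _ => norm_nonneg _)
        (fun _ _ => ContinuousLinearMap.norm_fst_le ℝ E E)
    have hsnd : ∀ i, ‖iteratedFDeriv ℝ i (fun z : E × E => U z.2) z‖ ≤
        ‖iteratedFDeriv ℝ i U z.2‖ := by
      intro i
      have := (ContinuousLinearMap.snd ℝ E E).iteratedFDeriv_comp_right (U.smooth ⊤) z
        (i := i) (by exact_mod_cast le_top)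
      have e : (⇑U ∘ ⇑(ContinuousLinearMap.snd ℝ E E)) = (fun z : E × E => U z.2) := rfl
      rw [e] at this
      rw [this]
      refine (ContinuousMultilinearMap.norm_compContinuousLinearMap_le _ _).trans ?_
      refine mul_le_of_le_one_right (norm_nonneg _) ?_
      exact Finset.prod_le_one (fun _ _ => norm_nonneg _)
        (fun _ _ => ContinuousLinearMap.norm_snd_le ℝ E E)
    refine (mul_le_mul_of_nonneg_left h1 (by positivity)).trans ?_
    rw [Finset.mul_sum]
    refine Finset.sum_le_sum fun i _ => ?_
    have hz : ‖z‖ ^ k ≤ ‖z.1‖ ^ k + ‖z.2‖ ^ k := by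
      rw [Prod.norm_def]
      rcases max_cases ‖z.1‖ ‖z.2‖ with h | h <;> rw [h.1]
      · linarith [pow_nonneg (norm_nonneg z.2) k]
      · linarith [pow_nonneg (norm_nonneg z.1) k]
    have a1 := SchwartzMap.le_seminorm ℝ k i f z.1
    have a2 := SchwartzMap.le_seminorm ℝ 0 i f z.1
    have b1 := SchwartzMap.le_seminorm ℝ k (n - i) U z.2
    have b2 := SchwartzMap.le_seminorm ℝ 0 (n - i) U z.2
    rw [pow_zero, one_mul] at a2 b2
    calc _ ≤ (‖z.1‖ ^ k + ‖z.2‖ ^ k) * (n.choose i * ‖iteratedFDeriv ℝ i f z.1‖ *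
          ‖iteratedFDeriv ℝ (n - i) U z.2‖) := by
          gcongr
          · exact hfst i
          · exact hsnd _
      _ = n.choose i * ((‖z.1‖ ^ k * ‖iteratedFDeriv ℝ i f z.1‖) * ‖iteratedFDeriv ℝ (n - i) U z.2‖
          + ‖iteratedFDeriv ℝ i f z.1‖ * (‖z.2‖ ^ k * ‖iteratedFDeriv ℝ (n - i) U z.2‖)) := by ring
      _ ≤ _ := by
          simp only [F]
          gcongr

lemma tens_apply (f U : SchwartzMap E ℂ) (z : E × E) : tens f U z = f z.1 * U z.2 := rfl

end TQ


section Dual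
variable {E : Type*} [NormedAddCommGroup E] [InnerProductSpace ℝ E] [FiniteDimensional ℝ E]
  [MeasurableSpace E] [BorelSpace E]

set_option linter.unusedSectionVars false

/-- Full Fourier transform on `E × E`. -/
def ftQ (Φ : SchwartzMap (E × E) ℂ) : SchwartzMap (E × E) ℂ :=
  SchwartzMap.compCLMOfContinuousLinearEquiv ℂ (WithLp.prodContinuousLinearEquiv 2 ℝ E E).symm
    (𝓕 (SchwartzMap.compCLMOfContinuousLinearEquiv ℂ (WithLp.prodContinuousLinearEquiv 2 ℝ E E) Φ))

/-- Full inverse Fourier transform on `E × E`. -/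
def iftQ (Φ : SchwartzMap (E × E) ℂ) : SchwartzMap (E × E) ℂ :=
  SchwartzMap.compCLMOfContinuousLinearEquiv ℂ (WithLp.prodContinuousLinearEquiv 2 ℝ E E).symm
    (𝓕⁻ (SchwartzMap.compCLMOfContinuousLinearEquiv ℂ (WithLp.prodContinuousLinearEquiv 2 ℝ E E) Φ))

lemma ft_iftQ (Φ : SchwartzMap (E × E) ℂ) : ftQ (iftQ Φ) = Φ := by
  have h : ∀ f : SchwartzMap (WithLp 2 (E × E)) ℂ,
      (SchwartzMap.compCLMOfContinuousLinearEquiv ℂ (WithLp.prodContinuousLinearEquiv 2 ℝ E E)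
      (SchwartzMap.compCLMOfContinuousLinearEquiv ℂ
        (WithLp.prodContinuousLinearEquiv 2 ℝ E E).symm f)) = f := by
    intro f; ext x; simp
  unfold ftQ iftQ
  rw [h, FourierTransform.fourier_fourierInv_eq]
  ext x; simp

lemma ftQ_apply (Φ : SchwartzMap (E × E) ℂ) (ξ η : E) :
    ftQ Φ (ξ, η) = ∫ z : E × E,
      Complex.exp (((-2 * Real.pi * (inner ℝ z.1 ξ + inner ℝ z.2 η) : ℝ) : ℂ) * I) * Φ z := by
  unfold ftQ
  rw [SchwartzMap.compCLMOfContinuousLinearEquiv_apply, Function.comp_apply, SchwartzMap.fourier_coe,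
    Real.fourier_eq', ← (WithLp.volume_preserving_toLp E E).integral_comp
      (WithLp.prodContinuousLinearEquiv 2 ℝ E E).symm.toHomeomorph.measurableEmbedding]
  rfl

lemma decay_slice (Φ : SchwartzMap (E × E) ℂ) : ∃ b : E → ℝ, Integrable b ∧
    (∀ x y, ‖Φ (x, y)‖ ≤ b y) ∧ (∀ x y, ‖Φ (x, y)‖ ≤ b x) := by
  obtain ⟨n, hn⟩ := Measure.HasTemperateGrowth.exists_integrable (μ := (volume : Measure E))
  let C : ℝ := 2 ^ n * ((Finset.Iic (n, 0)).sup fun m => SchwartzMap.seminorm ℝ m.1 m.2) Φ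
  have hC : ∀ z, (1 + ‖z‖) ^ n * ‖Φ z‖ ≤ C := by
    intro z
    have := SchwartzMap.one_add_le_sup_seminorm_apply (𝕜 := ℝ) (m := (n, 0)) le_rfl le_rfl Φ z
    simpa using this
  have key : ∀ (z : E × E) (y : E), ‖y‖ ≤ ‖z‖ → ‖Φ z‖ ≤ C * (1 + ‖y‖) ^ (-(n : ℝ)) := by
    intro z y hy
    rw [Real.rpow_neg (by positivity), Real.rpow_natCast, ← div_eq_mul_inv,
      le_div_iff₀ (by positivity)]
    calc _ = (1 + ‖y‖) ^ n * ‖Φ z‖ := by ring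
      _ ≤ (1 + ‖z‖) ^ n * ‖Φ z‖ := by gcongr
      _ ≤ C := hC z
  exact ⟨_, hn.const_mul C, fun x y => key _ _ (norm_snd_le (x, y)),
    fun x y => key _ _ (norm_fst_le (x, y))⟩

lemma integrable_slice (Φ : SchwartzMap (E × E) ℂ) (x : E) : Integrable (fun y => Φ (x, y)) := by
  obtain ⟨b, hb, h1, -⟩ := decay_slice Φ
  exact hb.mono' (Continuous.aestronglyMeasurable (by have := Φ.continuous; fun_prop))
    (Eventually.of_forall fun y => h1 x y)

lemma integrable_slice' (Φ : SchwartzMap (E × E) ℂ) (y : E) : Integrable (fun x => Φ (x, y)) := by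
  obtain ⟨b, hb, -, h1⟩ := decay_slice Φ
  exact hb.mono' (Continuous.aestronglyMeasurable (by have := Φ.continuous; fun_prop))
    (Eventually.of_forall fun x => h1 x y)

lemma integrable_sch (Φ : SchwartzMap (E × E) ℂ) : Integrable (Φ : E × E → ℂ) := by
  have := temp_prod (E := E)
  exact Φ.integrable

/-- partial Fourier transform -/
def pft (Φ : SchwartzMap (E × E) ℂ) (x s : E) : ℂ :=
  ∫ y, Complex.exp (((-2 * Real.pi * inner ℝ y s : ℝ) : ℂ) * I) * Φ (x, y)

lemma integrable_pft_aux (Φ : SchwartzMap (E × E) ℂ) (s : E) : Integrable (fun z : E × E =>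
    Complex.exp (((-2 * Real.pi * inner ℝ z.2 s : ℝ) : ℂ) * I) * Φ z) :=
  integrable_exp_mul (integrable_sch Φ) (by fun_prop)

lemma integrable_pft (Φ : SchwartzMap (E × E) ℂ) (s : E) : Integrable (fun x => pft Φ x s) :=
  (integrable_pft_aux Φ s).integral_prod_left

lemma continuous_pft (Φ : SchwartzMap (E × E) ℂ) (s : E) : Continuous (fun x => pft Φ x s) := by
  obtain ⟨b, hb, h1, -⟩ := decay_slice Φ
  have hc := Φ.continuous
  unfold pft
  refine continuous_of_dominated (bound := b) ?_ ?_ hb ?_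
  · intro x
    exact Continuous.aestronglyMeasurable (by fun_prop)
  · intro x
    refine Eventually.of_forall fun y => ?_
    rw [norm_mul, norm_expI, one_mul]; exact h1 x y
  · exact Eventually.of_forall fun y => by fun_prop

lemma fourier_pft (Φ : SchwartzMap (E × E) ℂ) (s : E) :
    𝓕 (fun x => pft Φ x s) = fun ξ => ftQ Φ (ξ, s) := by
  ext ξ
  rw [Real.fourier_eq', ftQ_apply, Measure.volume_eq_prod, integral_prod]
  · refine integral_congr_ae (Eventually.of_forall fun x => ?_)
    simp only [smul_eq_mul, pft]
    rw [← integral_const_mul]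
    refine integral_congr_ae (Eventually.of_forall fun y => ?_)
    simp only
    rw [← mul_assoc, ← Complex.exp_add]
    congr 2
    push_cast; ring
  · rw [← Measure.volume_eq_prod]
    exact integrable_exp_mul (integrable_sch Φ) (by fun_prop)

lemma pft_eq (Φ : SchwartzMap (E × E) ℂ) (x s : E) : pft Φ x s =
    ∫ ξ, Complex.exp (((2 * Real.pi * inner ℝ ξ x : ℝ) : ℂ) * I) * ftQ Φ (ξ, s) := by
  have h := (continuous_pft Φ s).fourierInv_fourier_eq (integrable_pft Φ s)
    (by rw [fourier_pft]; exact integrable_slice' _ s)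
  rw [fourier_pft] at h
  have := congrFun h x
  rw [← this, Real.fourierInv_eq']
  rfl

/-- the dual Schwartz function -/
def dualQ (Φ : SchwartzMap (E × E) ℂ) : SchwartzMap (E × E) ℂ :=
  SchwartzMap.compCLMOfContinuousLinearEquiv ℂ
    ((ContinuousLinearEquiv.prodComm ℝ E E).trans
      ((ContinuousLinearEquiv.neg ℝ).prodCongr (ContinuousLinearEquiv.refl ℝ E))) (ftQ Φ)

lemma dualQ_apply (Φ : SchwartzMap (E × E) ℂ) (z : E × E) : dualQ Φ z = ftQ Φ (-z.2, z.1) := rfl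

lemma dualQ_surj (Φ : SchwartzMap (E × E) ℂ) : ∃ Φ', dualQ Φ' = Φ := by
  refine ⟨iftQ (SchwartzMap.compCLMOfContinuousLinearEquiv ℂ
    ((ContinuousLinearEquiv.prodComm ℝ E E).trans
      ((ContinuousLinearEquiv.refl ℝ E).prodCongr (ContinuousLinearEquiv.neg ℝ))) Φ), ?_⟩
  ext z
  rw [dualQ_apply, ft_iftQ]
  simp

lemma tQ_dual (j : ℕ) (Φ : SchwartzMap (E × E) ℂ) (τ : ℝ) (hτ : τ ≠ 0) :
    tQ j Φ τ = (((|τ|⁻¹) ^ (Module.finrank ℝ E + j) : ℝ) : ℂ) * tQ j (dualQ Φ) τ⁻¹ := by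
  have hA : tQ j Φ τ = ∫ x, ((‖x‖ ^ j : ℝ) : ℂ) * pft Φ x (τ • x) := by
    unfold tQ
    rw [Measure.volume_eq_prod, integral_prod]
    · refine integral_congr_ae (Eventually.of_forall fun x => ?_)
      simp only [pft]
      rw [← integral_const_mul]
      refine integral_congr_ae (Eventually.of_forall fun y => ?_)
      simp only
      rw [inner_smul_right, real_inner_comm x y]
      ring
    · rw [← Measure.volume_eq_prod]
      exact integrable_exp_mul (integrable_wt j Φ) (by fun_prop)
  have hB : tQ j (dualQ Φ) τ⁻¹ = ∫ s, ((‖s‖ ^ j : ℝ) : ℂ) * pft Φ (τ⁻¹ • s) s := by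
    unfold tQ
    rw [Measure.volume_eq_prod, integral_prod]
    · refine integral_congr_ae (Eventually.of_forall fun s => ?_)
      simp only [pft_eq]
      rw [← integral_const_mul, ← integral_neg_eq_self]
      refine integral_congr_ae (Eventually.of_forall fun ξ => ?_)
      simp only [dualQ_apply, neg_neg]
      rw [inner_smul_right, inner_neg_right, real_inner_comm s ξ]
      have : -2 * Real.pi * (τ⁻¹ * -(inner ℝ s ξ)) = 2 * Real.pi * (τ⁻¹ * inner ℝ s ξ) := by ring
      rw [this]
      ring
    · rw [← Measure.volume_eq_prod]
      exact integrable_exp_mul (integrable_wt j _) (by fun_prop)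
  rw [hA, hB]
  have hC := Measure.integral_comp_smul (volume : Measure E)
    (fun s => ((‖τ⁻¹ • s‖ ^ j : ℝ) : ℂ) * pft Φ (τ⁻¹ • s) s) τ
  simp only [smul_smul, inv_mul_cancel₀ hτ, one_smul] at hC
  rw [hC, pow_add]
  simp only [norm_smul, norm_inv, Real.norm_eq_abs, mul_pow]
  rw [abs_inv, abs_pow, ← inv_pow]
  push_cast
  simp only [mul_assoc]
  rw [integral_const_mul, Complex.real_smul]
  push_cast
  rfl

end Dual


section Realise
variable {E : Type*} [NormedAddCommGroup E] [InnerProductSpace ℝ E] [FiniteDimensional ℝ E]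
  [MeasurableSpace E] [BorelSpace E]

set_option linter.unusedSectionVars false

lemma integral_transvection (e x : E) (he : ‖e‖ = 1) (hx : 0 < inner ℝ x e) (F : E → ℂ) :
    ((inner ℝ x e : ℝ) : ℂ) * ∫ y, F (y + inner ℝ (x - e) y • e) = ∫ z, F z := by
  let A : E →ₗ[ℝ] E := LinearMap.transvection (innerSL ℝ (x - e)).toLinearMap e
  have hA : ∀ y, A y = y + inner ℝ (x - e) y • e := fun y => by
    simp [A, LinearMap.transvection.apply, inner_sub_left]
  have hdet : LinearMap.det A = inner ℝ x e := by
    simp [A, LinearMap.transvection.det, inner_sub_left, he]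
  have hb : Function.Bijective A := by
    have : IsUnit A := by
      rw [LinearMap.isUnit_iff_isUnit_det, hdet]
      exact hx.ne'.isUnit
    exact (Module.End.isUnit_iff _).1 this
  let L : E →L[ℝ] E := LinearMap.toContinuousLinearMap A
  have h := integral_image_eq_integral_abs_det_fderiv_smul (volume : Measure E) (s := Set.univ)
    (f := A) (f' := fun _ => L) MeasurableSet.univ
    (fun y _ => L.hasFDerivAt.hasFDerivWithinAt) hb.injective.injOn F
  rw [Set.image_univ, hb.surjective.range_eq, setIntegral_univ, setIntegral_univ] at h
  rw [h]
  have hd : L.det = inner ℝ x e := hdet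
  simp only [hd, abs_of_pos hx, hA]
  rw [integral_smul, Complex.real_smul]

lemma exists_schwartz_slice (e : E) (he : ‖e‖ = 1) (γ : ℝ → ℂ) (hγ : ContDiff ℝ ∞ γ)
    (hc : HasCompactSupport γ) : ∃ U : SchwartzMap E ℂ, ∀ τ : ℝ,
      ∫ z, Complex.exp (((-2 * Real.pi * (τ * inner ℝ z e) : ℝ) : ℂ) * I) * U z = γ τ := by
  obtain ⟨R, hR⟩ := hc.isCompact.isBounded.subset_closedBall (0 : ℝ)
  let ρ : ContDiffBump (0 : E) := ⟨|R| + 1, |R| + 2, by positivity, by linarith⟩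
  let G : E → ℂ := fun s => ((ρ s : ℝ) : ℂ) * γ (inner ℝ s e)
  have hG : ContDiff ℝ ∞ G := by
    have h1 : ContDiff ℝ ∞ (fun s => ((ρ s : ℝ) : ℂ)) :=
      Complex.ofRealCLM.contDiff.comp ρ.contDiff
    have h2 : ContDiff ℝ ∞ (fun s : E => γ (inner ℝ s e)) :=
      hγ.comp (contDiff_id.inner ℝ contDiff_const)
    exact h1.mul h2
  have hGc : HasCompactSupport G := by
    have : HasCompactSupport (fun s => ((ρ s : ℝ) : ℂ)) :=
      ρ.hasCompactSupport.comp_left (g := fun r : ℝ => (r : ℂ)) (by simp)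
    exact this.mul_right
  refine ⟨𝓕⁻ (hGc.toSchwartzMap hG), fun τ => ?_⟩
  have h : (𝓕 (𝓕⁻ (hGc.toSchwartzMap hG))) (τ • e) = G (τ • e) := by
    rw [FourierTransform.fourier_fourierInv_eq]; rfl
  rw [SchwartzMap.fourier_coe, Real.fourier_eq'] at h
  simp only [inner_smul_right, smul_eq_mul] at h
  rw [h]
  simp only [G]
  rw [inner_smul_left, real_inner_self_eq_norm_sq, he]
  simp only [conj_trivial, one_pow, mul_one]
  by_cases ht : τ ∈ tsupport γ
  · have h3 := hR ht
    rw [mem_closedBall_zero_iff, Real.norm_eq_abs] at h3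
    rw [ρ.one_of_mem_closedBall]
    · simp
    · rw [mem_closedBall_zero_iff, norm_smul, he, mul_one, Real.norm_eq_abs]
      change |τ| ≤ |R| + 1
      linarith [le_abs_self R]
  · rw [image_eq_zero_of_notMem_tsupport ht, mul_zero]

lemma realise_one [Nontrivial E] (j : ℕ) (γ : ℝ → ℂ) (hγ : ContDiff ℝ ∞ γ)
    (hc : HasCompactSupport γ) : ∃ Φ : SchwartzMap (E × E) ℂ, ∀ τ, tQ j Φ τ = γ τ := by
  obtain ⟨e, he⟩ : ∃ e : E, ‖e‖ = 1 := exists_norm_eq E zero_le_one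
  obtain ⟨U, hU⟩ := exists_schwartz_slice e he γ hγ hc
  let β : ContDiffBump e := ⟨1/4, 1/2, by norm_num, by norm_num⟩
  let κ : ContDiffBump e := ⟨1/2, 3/4, by norm_num, by norm_num⟩
  -- constant
  let c : ℝ := ∫ x, ‖x‖ ^ j * β x
  have hβc : Continuous (fun x => β x) := β.continuous
  have hint : Integrable (fun x => ‖x‖ ^ j * β x) := by
    refine Continuous.integrable_of_hasCompactSupport (by fun_prop) ?_
    exact β.hasCompactSupport.mul_left
  have hcpos : 0 < c := by
    refine (Continuous.integral_pos_of_hasCompactSupport_nonneg_nonzero (x := e) (by fun_prop)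
      β.hasCompactSupport.mul_left (fun x => mul_nonneg (by positivity) β.nonneg) ?_)
    rw [he, β.one_of_mem_closedBall (by simp [β])]
    simp
  have hκc : Function.HasTemperateGrowth (fun x : E => κ x) :=
    κ.hasCompactSupport.hasTemperateGrowth κ.contDiff
  -- the function in x
  let f0 : E → ℂ := fun x => ((c⁻¹ * (β x * inner ℝ x e) : ℝ) : ℂ)
  have hf0 : ContDiff ℝ ∞ f0 := by
    refine Complex.ofRealCLM.contDiff.comp ?_
    exact contDiff_const.mul (β.contDiff.mul (contDiff_id.inner ℝ contDiff_const))
  have hf0c : HasCompactSupport f0 := by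
    have : HasCompactSupport (fun x => β x * inner ℝ x e) := β.hasCompactSupport.mul_right
    exact this.comp_left (g := fun r : ℝ => ((c⁻¹ * r : ℝ) : ℂ)) (by simp)
  let f : SchwartzMap E ℂ := hf0c.toSchwartzMap hf0
  have hfv : ∀ x, f x = ((c⁻¹ * (β x * inner ℝ x e) : ℝ) : ℂ) := fun x => rfl
  -- the change of variables
  let g : E × E → E × E := fun z => (z.1, z.2 + (κ z.1 * inner ℝ (z.1 - e) z.2) • e)
  have hgeq : g = fun z => z +
      (κ z.1 * inner ℝ (z.1 - e) z.2) • ((0, e) : E × E) := by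
    funext z; simp [g, Prod.ext_iff]
  have hg : g.HasTemperateGrowth := by
    rw [hgeq]
    have h1 : Function.HasTemperateGrowth (fun z : E × E => κ z.1) :=
      hκc.comp (ContinuousLinearMap.fst ℝ E E).hasTemperateGrowth
    have h2 : Function.HasTemperateGrowth (fun z : E × E => (inner ℝ (z.1 - e) z.2 : ℝ)) := by
      have := ContinuousLinearMap.bilinear_hasTemperateGrowth (𝕜 := ℝ) (innerSL ℝ (E := E))
        (f := fun z : E × E => z.1 - e) (g := fun z : E × E => z.2)
        ((ContinuousLinearMap.fst ℝ E E).hasTemperateGrowth.sub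
          (Function.HasTemperateGrowth.const e))
        (ContinuousLinearMap.snd ℝ E E).hasTemperateGrowth
      exact this
    exact Function.HasTemperateGrowth.id'.add
      ((h1.mul h2).smul (Function.HasTemperateGrowth.const _))
  have hup : ∃ (k : ℕ) (C : ℝ), ∀ z, ‖z‖ ≤ C * (1 + ‖g z‖) ^ k := by
    refine ⟨1, 4, fun z => ?_⟩
    have hk : |κ z.1 * inner ℝ (z.1 - e) z.2| ≤ 3 / 4 * ‖z.2‖ := by
      rw [abs_mul, abs_of_nonneg κ.nonneg]
      have h1 := abs_real_inner_le_norm (z.1 - e) z.2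
      by_cases hz : z.1 ∈ Metric.ball e (3/4)
      · rw [Metric.mem_ball, dist_eq_norm] at hz
        calc κ z.1 * |inner ℝ (z.1 - e) z.2| ≤ 1 * (‖z.1 - e‖ * ‖z.2‖) := by
              gcongr; exact κ.le_one
          _ ≤ _ := by rw [one_mul]; gcongr
      · rw [κ.zero_of_le_dist (by simpa using hz), zero_mul]; positivity
    have h1 : ‖z.1‖ ≤ ‖g z‖ := norm_fst_le (g z)
    have h2 : ‖z.2 + (κ z.1 * inner ℝ (z.1 - e) z.2) • e‖ ≤ ‖g z‖ := norm_snd_le (g z)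
    have h3 : ‖z.2‖ ≤ ‖z.2 + (κ z.1 * inner ℝ (z.1 - e) z.2) • e‖ + 3 / 4 * ‖z.2‖ := by
      have := norm_sub_le (z.2 + (κ z.1 * inner ℝ (z.1 - e) z.2) • e)
        ((κ z.1 * inner ℝ (z.1 - e) z.2) • e)
      rw [add_sub_cancel_right, norm_smul _ e, he, mul_one, Real.norm_eq_abs] at this
      linarith
    rw [pow_one, Prod.norm_def]
    have h0 := norm_nonneg (g z)
    refine max_le ?_ ?_ <;> linarith
  let Φ : SchwartzMap (E × E) ℂ := SchwartzMap.compCLM ℂ hg hup (tens f U)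
  have hΦ : ∀ x y, Φ (x, y) = f x * U (y + (κ x * inner ℝ (x - e) y) • e) := fun x y => rfl
  refine ⟨Φ, fun τ => ?_⟩
  unfold tQ
  rw [Measure.volume_eq_prod, integral_prod]
  swap
  · rw [← Measure.volume_eq_prod]
    exact integrable_exp_mul (integrable_wt j _) (by fun_prop)
  have key : ∀ x : E, (∫ y, Complex.exp (((-2 * Real.pi * (τ * inner ℝ x y) : ℝ) : ℂ) * I) *
    (((‖x‖ ^ j : ℝ) : ℂ) * Φ (x, y))) = ((c⁻¹ * (‖x‖ ^ j * β x) : ℝ) : ℂ) * γ τ := by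
    intro x
    by_cases hx : x ∈ Metric.ball e (1/2)
    · have hκ1 : κ x = 1 := κ.one_of_mem_closedBall (Metric.ball_subset_closedBall hx)
      have hxe : 0 < inner ℝ x e := by
        rw [Metric.mem_ball, dist_eq_norm] at hx
        have h1 := abs_real_inner_le_norm (x - e) e
        rw [he, mul_one] at h1
        have h2 : inner ℝ (x - e) e = inner ℝ x e - 1 := by
          rw [inner_sub_left, real_inner_self_eq_norm_sq, he]; norm_num
        rw [h2] at h1
        have := (abs_le.1 h1).1
        linarith
      have hin : ∀ y, inner ℝ x y = inner ℝ (y + inner ℝ (x - e) y • e) e := by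
        intro y
        rw [inner_add_left, inner_smul_left, real_inner_self_eq_norm_sq, he, inner_sub_left,
          real_inner_comm e y]
        simp
      have hT := integral_transvection e x he hxe (fun z =>
        Complex.exp (((-2 * Real.pi * (τ * inner ℝ z e) : ℝ) : ℂ) * I) * U z)
      rw [hU] at hT
      rw [← hT, ← mul_assoc, ← integral_const_mul]
      refine integral_congr_ae (Eventually.of_forall fun y => ?_)
      simp only [hΦ, hκ1, one_mul, hfv]
      rw [← hin]
      push_cast
      ring
    · have : β x = 0 := β.zero_of_le_dist (by
        change (1/2:ℝ) ≤ _
        simpa using hx)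
      simp [hΦ, hfv, this]
  simp only [key]
  rw [integral_mul_const, integral_complex_ofReal, integral_const_mul]
  change ((c⁻¹ * c : ℝ) : ℂ) * γ τ = γ τ
  rw [inv_mul_cancel₀ hcpos.ne']; simp

lemma tQ_add (j : ℕ) (Φ Ψ : SchwartzMap (E × E) ℂ) (τ : ℝ) :
    tQ j (Φ + Ψ) τ = tQ j Φ τ + tQ j Ψ τ := by
  unfold tQ
  rw [← integral_add]
  · refine integral_congr_ae (Eventually.of_forall fun z => ?_)
    simp only [add_apply]; ring
  · exact integrable_exp_mul (integrable_wt j _) (by fun_prop)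
  · exact integrable_exp_mul (integrable_wt j _) (by fun_prop)

lemma realise_two [Nontrivial E] (j m : ℕ) (hm : Module.finrank ℝ E + j = m) (p δ : ℝ → ℂ)
    (hp : ContDiff ℝ ∞ p) (hδ : ContDiff ℝ ∞ δ)
    (hpδ : ∀ τ, τ ≠ 0 → p τ = (((|τ|⁻¹) ^ m : ℝ) : ℂ) * δ τ⁻¹) :
    ∃ Φ : SchwartzMap (E × E) ℂ, ∀ τ, tQ j Φ τ = p τ := by
  let χ : ContDiffBump (0 : ℝ) := ⟨1, 2, by norm_num, by norm_num⟩
  have hχ : ContDiff ℝ ∞ (fun t => ((χ t : ℝ) : ℂ)) := Complex.ofRealCLM.contDiff.comp χ.contDiff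
  have hχc : HasCompactSupport (fun t => ((χ t : ℝ) : ℂ)) :=
    χ.hasCompactSupport.comp_left (g := fun r : ℝ => (r : ℂ)) (by simp)
  obtain ⟨Φ₁, h1⟩ := realise_one (E := E) j (fun t => ((χ t : ℝ) : ℂ) * p t) (hχ.mul hp)
    hχc.mul_right
  let δ₁ : ℝ → ℂ := fun s => (1 - ((χ s⁻¹ : ℝ) : ℂ)) * δ s
  let δ₂ : ℝ → ℂ := fun s => if s = 0 then δ 0 else δ₁ s
  have hδ₂ : ContDiff ℝ ∞ δ₂ := by
    rw [contDiff_iff_contDiffAt]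
    intro s
    by_cases hs : s = 0
    · subst hs
      refine hδ.contDiffAt.congr_of_eventuallyEq ?_
      filter_upwards [Metric.ball_mem_nhds (0 : ℝ) (show (0 : ℝ) < 1 / 2 by norm_num)] with s hs
      simp only [δ₂]
      split_ifs with h
      · rw [h]
      · have : χ s⁻¹ = 0 := by
          refine χ.zero_of_le_dist ?_
          rw [mem_ball_zero_iff, Real.norm_eq_abs] at hs
          rw [dist_zero_right, norm_inv, Real.norm_eq_abs]
          have h0 : 0 < |s| := abs_pos.2 h
          change (2 : ℝ) ≤ _
          rw [le_inv_comm₀ (by norm_num) h0]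
          linarith
        simp [δ₁, this]
    · have h : ContDiffAt ℝ ∞ δ₁ s := by
        have hi : ContDiffAt ℝ ∞ (fun s : ℝ => s⁻¹) s := contDiffAt_inv ℝ hs
        exact (contDiffAt_const.sub (hχ.contDiffAt.comp s hi)).mul hδ.contDiffAt
      refine h.congr_of_eventuallyEq ?_
      filter_upwards [isOpen_ne.mem_nhds hs] with t ht
      simp only [δ₂]; rw [if_neg ht]
  have hδ₂c : HasCompactSupport δ₂ := by
    refine HasCompactSupport.intro (isCompact_closedBall (0 : ℝ) 1) fun s hs => ?_
    rw [mem_closedBall_zero_iff, Real.norm_eq_abs, not_le] at hs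
    have h0 : s ≠ 0 := by rintro rfl; simp at hs; linarith
    simp only [δ₂, if_neg h0, δ₁]
    rw [χ.one_of_mem_closedBall]
    · simp
    · rw [mem_closedBall_zero_iff, norm_inv, Real.norm_eq_abs]
      exact inv_le_one_of_one_le₀ hs.le
  obtain ⟨Φ₂', h2'⟩ := realise_one (E := E) j δ₂ hδ₂ hδ₂c
  obtain ⟨Φ₂, rfl⟩ := dualQ_surj Φ₂'
  refine ⟨Φ₁ + Φ₂, fun τ => ?_⟩
  have hne : ∀ τ, τ ≠ 0 → tQ j (Φ₁ + Φ₂) τ = p τ := by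
    intro τ hτ
    rw [tQ_add, h1, tQ_dual j Φ₂ τ hτ, h2', hm]
    simp only [δ₂, if_neg (inv_ne_zero hτ), δ₁, inv_inv]
    rw [mul_left_comm, ← hpδ τ hτ]; ring
  have hcl : Set.EqOn (tQ j (Φ₁ + Φ₂)) p (closure {0}ᶜ) :=
    Set.EqOn.closure (fun τ hτ => hne τ hτ) (contDiff_tQ j _).continuous hp.continuous
  exact hcl (by rw [(dense_compl_singleton (0 : ℝ)).closure_eq]; trivial)

end Realise

lemma transfer {E E' : Type*} [NormedAddCommGroup E] [InnerProductSpace ℝ E]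
    [FiniteDimensional ℝ E] [MeasurableSpace E] [BorelSpace E]
    [NormedAddCommGroup E'] [InnerProductSpace ℝ E'] [FiniteDimensional ℝ E']
    [MeasurableSpace E'] [BorelSpace E'] [Nontrivial E'] (j j' : ℕ)
    (hj : Module.finrank ℝ E + j = Module.finrank ℝ E' + j') (Φ : SchwartzMap (E × E) ℂ) :
    ∃ Φ' : SchwartzMap (E' × E') ℂ, ∀ τ, tQ j Φ τ = tQ j' Φ' τ := by
  obtain ⟨Φ', h⟩ := realise_two (E := E') j' _ hj.symm (tQ j Φ) (tQ j (dualQ Φ))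
    (contDiff_tQ _ _) (contDiff_tQ _ _) (fun τ hτ => tQ_dual j Φ τ hτ)
  exact ⟨Φ', fun τ => (h τ).symm⟩


section Uniq

lemma fourier_pair {α : Type*} [TopologicalSpace α] [MeasurableSpace α] [OpensMeasurableSpace α]
    {μ : Measure α} [SFinite μ] [SecondCountableTopology α] {f : α → ℂ} (hf : Integrable f μ) {Q : α → ℝ} (hQ : Continuous Q)
    (G : SchwartzMap ℝ ℂ) :
    ∫ z, G (Q z) * f z ∂μ = ∫ τ : ℝ, (𝓕⁻ G) τ *
      ∫ z, Complex.exp (((-2 * Real.pi * (τ * Q z) : ℝ) : ℂ) * I) * f z ∂μ := by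
  have hG : ∀ t, G t = ∫ τ : ℝ, Complex.exp (((-2 * Real.pi * (τ * t) : ℝ) : ℂ) * I) * (𝓕⁻ G) τ := by
    intro t
    have h : (𝓕 (𝓕⁻ G)) t = G t := by
      rw [FourierTransform.fourier_fourierInv_eq]
    rw [SchwartzMap.fourier_coe, Real.fourier_eq'] at h
    rw [← h]
    refine integral_congr_ae (Eventually.of_forall fun y => ?_)
    simp only [smul_eq_mul, RCLike.inner_apply, conj_trivial]
    rw [mul_comm y t]
  have hi : Integrable (fun p : ℝ × α => Complex.exp (((-2 * Real.pi * (p.1 * Q p.2) : ℝ) : ℂ) * I) *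
      ((𝓕⁻ G) p.1 * f p.2)) (volume.prod μ) := by
    refine integrable_exp_mul (Integrable.mul_prod (SchwartzMap.integrable _) hf) ?_
    fun_prop
  have h1 : ∀ z, G (Q z) * f z = ∫ τ : ℝ, Complex.exp (((-2 * Real.pi * (τ * Q z) : ℝ) : ℂ) * I) *
      ((𝓕⁻ G) τ * f z) := by
    intro z
    rw [hG (Q z), ← integral_mul_const]
    simp only [mul_assoc]
  have h2 : ∀ τ : ℝ, (𝓕⁻ G) τ *
      ∫ z, Complex.exp (((-2 * Real.pi * (τ * Q z) : ℝ) : ℂ) * I) * f z ∂μ =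
      ∫ z, Complex.exp (((-2 * Real.pi * (τ * Q z) : ℝ) : ℂ) * I) *
      ((𝓕⁻ G) τ * f z) ∂μ := by
    intro τ
    rw [← integral_const_mul]
    refine integral_congr_ae (Eventually.of_forall fun y => ?_)
    ring
  simp only [h1, h2]
  exact (integral_integral_swap hi).symm

lemma integrable_comp_mul {α : Type*} [TopologicalSpace α] [MeasurableSpace α]
    [OpensMeasurableSpace α] {μ : Measure α} {f : α → ℂ} (hf : Integrable f μ) {Q : α → ℝ}
    (hQ : Continuous Q) (g : ℝ → ℂ) (hg : Continuous g) (hc : HasCompactSupport g) :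
    Integrable (fun z => g (Q z) * f z) μ := by
  obtain ⟨C, hC⟩ := hg.bounded_above_of_compact_support hc
  exact hf.bdd_mul (c := C) (hg.comp hQ).aestronglyMeasurable (Eventually.of_forall fun z => hC _)

lemma uniq {α β : Type*} [TopologicalSpace α] [MeasurableSpace α] [OpensMeasurableSpace α]
    {μ : Measure α} [SFinite μ] [SecondCountableTopology α] {f : α → ℂ} (hf : Integrable f μ)
    {Q : α → ℝ} (hQ : Continuous Q)
    [TopologicalSpace β] [MeasurableSpace β] [OpensMeasurableSpace β]
    {ν : Measure β} [SFinite ν] [SecondCountableTopology β] {f' : β → ℂ} (hf' : Integrable f' ν)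
    {Q' : β → ℝ} (hQ' : Continuous Q')
    (h : ∀ τ : ℝ, ∫ z, Complex.exp (((-2 * Real.pi * (τ * Q z) : ℝ) : ℂ) * I) * f z ∂μ =
      ∫ z, Complex.exp (((-2 * Real.pi * (τ * Q' z) : ℝ) : ℂ) * I) * f' z ∂ν)
    (g : ℝ → ℂ) (hg : Continuous g) (hc : HasCompactSupport g) :
    ∫ z, g (Q z) * f z ∂μ = ∫ z, g (Q' z) * f' z ∂ν := by
  have key : ∀ G : SchwartzMap ℝ ℂ, ∫ z, G (Q z) * f z ∂μ = ∫ z, G (Q' z) * f' z ∂ν := by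
    intro G
    rw [fourier_pair hf hQ, fourier_pair hf' hQ']
    simp only [h]
  have est : ∀ ε : ℝ, 0 < ε → ‖∫ z, g (Q z) * f z ∂μ - ∫ z, g (Q' z) * f' z ∂ν‖ ≤
      ε * (∫ z, ‖f z‖ ∂μ + ∫ z, ‖f' z‖ ∂ν) := by
    intro ε hε
    obtain ⟨G, hG1, hG2, hG3⟩ := hg.exists_contDiff_approx ⊤ (ε := fun _ => ε) continuous_const
      (fun _ => hε)
    have hGc : HasCompactSupport G := hc.mono hG3
    have hk := key (hGc.toSchwartzMap hG1)
    change ∫ z, G (Q z) * f z ∂μ = ∫ z, G (Q' z) * f' z ∂ν at hk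
    have e1 : ‖∫ z, g (Q z) * f z ∂μ - ∫ z, G (Q z) * f z ∂μ‖ ≤ ε * ∫ z, ‖f z‖ ∂μ := by
      rw [← integral_sub (integrable_comp_mul hf hQ g hg hc)
        (integrable_comp_mul hf hQ G hG1.continuous hGc), ← integral_const_mul]
      refine norm_integral_le_of_norm_le (hf.norm.const_mul ε) (Eventually.of_forall fun z => ?_)
      rw [← sub_mul, norm_mul]
      gcongr
      have := hG2 (Q z)
      rw [dist_comm, dist_eq_norm] at this
      exact this.le
    have e2 : ‖∫ z, g (Q' z) * f' z ∂ν - ∫ z, G (Q' z) * f' z ∂ν‖ ≤ ε * ∫ z, ‖f' z‖ ∂ν := by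
      rw [← integral_sub (integrable_comp_mul hf' hQ' g hg hc)
        (integrable_comp_mul hf' hQ' G hG1.continuous hGc), ← integral_const_mul]
      refine norm_integral_le_of_norm_le (hf'.norm.const_mul ε) (Eventually.of_forall fun z => ?_)
      rw [← sub_mul, norm_mul]
      gcongr
      have := hG2 (Q' z)
      rw [dist_comm, dist_eq_norm] at this
      exact this.le
    rw [hk] at e1
    have := norm_sub_le_norm_sub_add_norm_sub (∫ z, g (Q z) * f z ∂μ) (∫ z, G (Q' z) * f' z ∂ν)
      (∫ z, g (Q' z) * f' z ∂ν)
    rw [norm_sub_rev (∫ z, G (Q' z) * f' z ∂ν)] at this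
    linarith
  have hlim : Tendsto (fun ε : ℝ => ε * (∫ z, ‖f z‖ ∂μ + ∫ z, ‖f' z‖ ∂ν)) (nhdsWithin 0 (Set.Ioi 0))
      (nhds 0) := by
    have : Tendsto (fun ε : ℝ => ε * (∫ z, ‖f z‖ ∂μ + ∫ z, ‖f' z‖ ∂ν)) (nhds 0)
      (nhds (0 * (∫ z, ‖f z‖ ∂μ + ∫ z, ‖f' z‖ ∂ν))) := (continuous_id.mul continuous_const).tendsto 0
    rw [zero_mul] at this
    exact this.mono_left nhdsWithin_le_nhds
  have := ge_of_tendsto hlim (eventually_nhdsWithin_of_forall est)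
  exact sub_eq_zero.1 (norm_le_zero_iff.1 this)

end Uniq


section TwoD

/-- integrand of the twisted pushforward with a natural exponent -/
def fTwo (k : ℕ) (Φ : SchwartzMap (ℝ × ℝ) ℂ) (a ξ : ℝ) : ℂ :=
  Φ (a, ξ / a) * ((|a| ^ k / |a| : ℝ) : ℂ)

lemma fTwo_zero (k : ℕ) (Φ : SchwartzMap (ℝ × ℝ) ℂ) (ξ : ℝ) : fTwo k Φ 0 ξ = 0 := by
  simp [fTwo]

lemma measurable_fTwo (k : ℕ) (Φ : SchwartzMap (ℝ × ℝ) ℂ) :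
    Measurable (fun p : ℝ × ℝ => fTwo k Φ p.1 p.2) := by
  unfold fTwo
  refine (Φ.continuous.measurable.comp (by fun_prop)).mul ?_
  exact Complex.measurable_ofReal.comp (by fun_prop)

lemma integrable_fTwo (k : ℕ) (Φ : SchwartzMap (ℝ × ℝ) ℂ) (ξ : ℝ) (hξ : ξ ≠ 0) :
    Integrable (fun a => fTwo k Φ a ξ) := by
  obtain ⟨C1, -, h1⟩ := Φ.decay (k + 1) 0
  obtain ⟨C2, -, h2⟩ := Φ.decay (k + 3) 0
  simp only [norm_iteratedFDeriv_zero] at h1 h2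
  refine (integrable_inv_one_add_sq.const_mul (|ξ|⁻¹ * (C1 + C2))).mono'
    ((measurable_fTwo k Φ).comp (measurable_id.prodMk measurable_const)).aestronglyMeasurable
    (Eventually.of_forall fun a => ?_)
  have hC : 0 ≤ C1 + C2 := by
    have := h1 0
    have := h2 0
    simp at *
    linarith
  rcases eq_or_ne a 0 with rfl | ha
  · rw [fTwo_zero]
    simp only [norm_zero]
    positivity
  · have ha' : 0 < |a| := abs_pos.2 ha
    have hx' : 0 < |ξ| := abs_pos.2 hξ
    set z : ℝ × ℝ := (a, ξ / a) with hz
    have n1 : |a| ≤ ‖z‖ := norm_fst_le z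
    have n2 : |ξ| / |a| ≤ ‖z‖ := by
      rw [← abs_div]; exact norm_snd_le z
    have e1 : |ξ| / |a| * |a| ^ k * ‖Φ z‖ ≤ C1 := by
      refine le_trans ?_ (h1 z)
      rw [pow_succ' ‖z‖]
      gcongr
    have e2 : |ξ| / |a| * |a| ^ k * a ^ 2 * ‖Φ z‖ ≤ C2 := by
      refine le_trans ?_ (h2 z)
      rw [← sq_abs a, mul_assoc (|ξ| / |a|), ← pow_add, show k + 3 = (k + 2) + 1 from rfl, pow_succ' ‖z‖]
      gcongr
    have : ‖fTwo k Φ a ξ‖ = ‖Φ z‖ * (|a| ^ k / |a|) := by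
      rw [fTwo, norm_mul, Complex.norm_real, Real.norm_of_nonneg (by positivity)]
    rw [this, ← div_eq_mul_inv, le_div_iff₀ (by positivity), inv_mul_eq_div, le_div_iff₀ hx']
    calc _ = |ξ| / |a| * |a| ^ k * ‖Φ z‖ + |ξ| / |a| * |a| ^ k * a ^ 2 * ‖Φ z‖ := by ring
      _ ≤ _ := add_le_add e1 e2

lemma fTwo_sub (k : ℕ) (Φ : SchwartzMap (ℝ × ℝ) ℂ) (a : ℝ) (ha : a ≠ 0) (g : ℝ → ℂ) :
    ∫ ξ, g ξ * fTwo k Φ a ξ = ∫ b, g (b * a) * (((|a| ^ k : ℝ) : ℂ) * Φ (a, b)) := by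
  have h := Measure.integral_comp_div (fun b => g (b * a) * (Φ (a, b) * ((|a| ^ k / |a| : ℝ) : ℂ))) a
  simp only [div_mul_cancel₀ _ ha] at h
  unfold fTwo
  rw [h, ← integral_smul]
  refine integral_congr_ae (Eventually.of_forall fun b => ?_)
  have ha' : ((|a| : ℝ) : ℂ) ≠ 0 := by exact_mod_cast (abs_pos.2 ha).ne'
  simp only [Complex.real_smul]
  push_cast
  field_simp

lemma ae_ne_zero' : ∀ᵐ a : ℝ, a ≠ 0 := by
  simp [ae_iff]

lemma integrable_fTwo_prod (k : ℕ) (Φ : SchwartzMap (ℝ × ℝ) ℂ) :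
    Integrable (fun p : ℝ × ℝ => fTwo k Φ p.1 p.2) ((volume : Measure ℝ).prod volume) := by
  rw [integrable_prod_iff (measurable_fTwo k Φ).aestronglyMeasurable]
  constructor
  · filter_upwards [ae_ne_zero'] with a ha
    exact (((integrable_slice Φ a).comp_div ha).mul_const _)
  · have h := (integrable_wt k Φ).norm
    rw [Measure.volume_eq_prod] at h
    refine h.integral_prod_left.congr ?_
    filter_upwards [ae_ne_zero'] with a ha
    have h := Measure.integral_comp_div (fun b => ‖Φ (a, b)‖ * (|a| ^ k / |a|)) a
    have hn : ∀ ξ, ‖fTwo k Φ a ξ‖ = ‖Φ (a, ξ / a)‖ * (|a| ^ k / |a|) := fun ξ => by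
      rw [fTwo, norm_mul, Complex.norm_real, Real.norm_of_nonneg (by positivity)]
    simp only [hn]
    rw [h, ← integral_smul]
    refine integral_congr_ae (Eventually.of_forall fun b => ?_)
    have ha' : |a| ≠ 0 := (abs_pos.2 ha).ne'
    simp only [norm_mul, Complex.norm_real, norm_pow, Real.norm_eq_abs, abs_abs, smul_eq_mul]
    field_simp

lemma exponent_eq (k : ℕ) (a : ℝ) :
    |a| ^ ((((2 * (k + 1) : ℕ) : ℝ) - 2) / 2) = |a| ^ k := by
  rw [← Real.rpow_natCast]
  congr 1
  push_cast
  ring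

lemma hTwoR_eq (k : ℕ) (Φ : SchwartzMap (ℝ × ℝ) ℂ) (ξ : ℝ) :
    hTwoR (2 * (k + 1)) Φ ξ = ∫ a, fTwo k Φ a ξ := by
  unfold hTwoR
  simp only [exponent_eq]
  refine setIntegral_eq_integral_of_forall_compl_eq_zero (f := fun a => fTwo k Φ a ξ) fun a ha => ?_
  have : a = 0 := by simpa using ha
  rw [this, fTwo_zero]

lemma integrable_hTwoR (k : ℕ) (Φ : SchwartzMap (ℝ × ℝ) ℂ) :
    Integrable (hTwoR (2 * (k + 1)) Φ) := by
  refine (integrable_fTwo_prod k Φ).integral_prod_right.congr (Eventually.of_forall fun ξ => ?_)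
  exact (hTwoR_eq k Φ ξ).symm

lemma integral_hTwoR (k : ℕ) (Φ : SchwartzMap (ℝ × ℝ) ℂ) (g : ℝ → ℂ) (hg : Continuous g)
    (hc : HasCompactSupport g) :
    ∫ ξ, g ξ * hTwoR (2 * (k + 1)) Φ ξ =
      ∫ z : ℝ × ℝ, g (inner ℝ z.1 z.2) * (((‖z.1‖ ^ k : ℝ) : ℂ) * Φ z) := by
  simp only [hTwoR_eq, ← integral_const_mul]
  have hi := integrable_comp_mul (integrable_fTwo_prod k Φ) (Q := Prod.snd) continuous_snd g hg hc
  rw [← integral_integral_swap hi]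
  have hi2 := integrable_comp_mul (integrable_wt k Φ) (Q := fun z : ℝ × ℝ => inner ℝ z.1 z.2)
    (by fun_prop) g hg hc
  rw [Measure.volume_eq_prod] at hi2 ⊢
  rw [integral_prod _ hi2]
  refine integral_congr_ae ?_
  filter_upwards [ae_ne_zero'] with a ha
  rw [fTwo_sub k Φ a ha g]
  rfl

end TwoD

section Coord

/-- interleaving of two copies of `Fin m` -/
def interF (m : ℕ) : Fin m ⊕ Fin m → Fin (2 * m) :=
  Sum.elim (fun i => ⟨2 * i, by omega⟩) (fun i => ⟨2 * i + 1, by omega⟩)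

lemma interF_bij (m : ℕ) : Function.Bijective (interF m) := by
  rw [Fintype.bijective_iff_injective_and_card]
  constructor
  · rintro (i | i) (j | j) h <;> simp [interF, Fin.ext_iff] at h ⊢ <;> omega
  · simp; ring

/-- interleaving of two copies of `Fin m` -/
def inter (m : ℕ) : Fin m ⊕ Fin m ≃ Fin (2 * m) := Equiv.ofBijective _ (interF_bij m)

/-- split coordinates into even and odd ones -/
def coordL (m : ℕ) : (Fin (2 * m) → ℝ) ≃ₗ[ℝ]
    EuclideanSpace ℝ (Fin m) × EuclideanSpace ℝ (Fin m) where
  toFun x := (WithLp.toLp 2 fun i => x (inter m (Sum.inl i)),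
    WithLp.toLp 2 fun i => x (inter m (Sum.inr i)))
  map_add' x y := rfl
  map_smul' c x := rfl
  invFun z := fun i => Sum.elim (fun i => z.1 i) (fun i => z.2 i) ((inter m).symm i)
  left_inv x := by
    funext i
    obtain ⟨s, rfl⟩ := (inter m).surjective i
    rcases s with s | s <;> simp
  right_inv z := by
    ext i <;> simp

/-- continuous version -/
def coordC (m : ℕ) : (Fin (2 * m) → ℝ) ≃L[ℝ]
    EuclideanSpace ℝ (Fin m) × EuclideanSpace ℝ (Fin m) := (coordL m).toContinuousLinearEquiv

lemma coordC_mp (m : ℕ) : MeasurePreserving (coordC m) := by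
  have h1 := (volume_measurePreserving_piCongrLeft (fun _ : Fin (2 * m) => ℝ) (inter m)).symm
  have h2 := volume_measurePreserving_sumPiEquivProdPi (fun _ : Fin m ⊕ Fin m => ℝ)
  have h3 := (PiLp.volume_preserving_toLp (Fin m)).prod (PiLp.volume_preserving_toLp (Fin m))
  exact h3.comp (h2.comp h1)

lemma splitQR_eq (m : ℕ) (x : Fin (2 * m) → ℝ) :
    splitQR (2 * m) x = inner ℝ (coordC m x).1 (coordC m x).2 := by
  rw [splitQR, if_pos (even_two_mul m), Nat.mul_div_cancel_left _ two_pos, Finset.sum_range,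
    PiLp.inner_apply]
  refine Finset.sum_congr rfl fun i _ => ?_
  have h1 : 2 * (i : ℕ) < 2 * m := by omega
  have h2 : 2 * (i : ℕ) + 1 < 2 * m := by omega
  rw [padR, padR, dif_pos h1, dif_pos h2]
  exact mul_comm _ _

lemma integral_coord (m : ℕ) (F : EuclideanSpace ℝ (Fin m) × EuclideanSpace ℝ (Fin m) → ℂ) :
    ∫ x, F (coordC m x) = ∫ z, F z :=
  (coordC_mp m).integral_comp (coordC m).toHomeomorph.measurableEmbedding F

end Coord

lemma final_uniq {E E' : Type*} [NormedAddCommGroup E] [InnerProductSpace ℝ E]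
    [FiniteDimensional ℝ E] [MeasurableSpace E] [BorelSpace E]
    [NormedAddCommGroup E'] [InnerProductSpace ℝ E'] [FiniteDimensional ℝ E']
    [MeasurableSpace E'] [BorelSpace E'] (j j' : ℕ)
    (Φ : SchwartzMap (E × E) ℂ) (Φ' : SchwartzMap (E' × E') ℂ) (h : ∀ τ, tQ j Φ τ = tQ j' Φ' τ)
    (g : ℝ → ℂ) (hg : Continuous g) (hc : HasCompactSupport g) :
    ∫ z : E × E, g (inner ℝ z.1 z.2) * (((‖z.1‖ ^ j : ℝ) : ℂ) * Φ z) =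
    ∫ z : E' × E', g (inner ℝ z.1 z.2) * (((‖z.1‖ ^ j' : ℝ) : ℂ) * Φ' z) :=
  uniq (integrable_wt j Φ) (Q := fun z : E × E => inner ℝ z.1 z.2) (by fun_prop)
    (integrable_wt j' Φ') (Q' := fun z : E' × E' => inner ℝ z.1 z.2) (by fun_prop) h g hg hc

/-- real, even-dimensional case of the reduction of pushforwards under
the split quadratic form in `d` variables to twisted pushforwards in `2` variables. -/
theorem pushforward_eq_twisted_pushforward_real_even (d : ℕ) (hd : 2 ≤ d) (hde : Even d) :
    (∀ Φ₂ : SchwartzMap (ℝ × ℝ) ℂ,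
      (∀ ξ : ℝ, ξ ≠ 0 → IntegrableOn
          (fun a : ℝ => Φ₂ (a, ξ / a) * ((|a| ^ (((d : ℝ) - 2) / 2) / |a| : ℝ) : ℂ))
          ({0}ᶜ : Set ℝ)) ∧
      LocallyIntegrable (hTwoR d Φ₂) volume) ∧
    (∀ Φ : SchwartzMap (Fin d → ℝ) ℂ, ∃ Φ₂ : SchwartzMap (ℝ × ℝ) ℂ,
      ∀ g : ℝ → ℂ, Continuous g → HasCompactSupport g →
        ∫ x : Fin d → ℝ, g (splitQR d x) * Φ x = ∫ ξ : ℝ, g ξ * hTwoR d Φ₂ ξ) ∧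
    (∀ Φ₂ : SchwartzMap (ℝ × ℝ) ℂ, ∃ Φ : SchwartzMap (Fin d → ℝ) ℂ,
      ∀ g : ℝ → ℂ, Continuous g → HasCompactSupport g →
        ∫ x : Fin d → ℝ, g (splitQR d x) * Φ x = ∫ ξ : ℝ, g ξ * hTwoR d Φ₂ ξ) := by
  obtain ⟨m, hm⟩ := hde.two_dvd
  obtain ⟨k, rfl⟩ : ∃ k, m = k + 1 := ⟨m - 1, by omega⟩
  subst hm
  refine ⟨fun Φ₂ => ⟨fun ξ hξ => ?_, (integrable_hTwoR k Φ₂).locallyIntegrable⟩, fun Φ => ?_,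
    fun Φ₂ => ?_⟩
  · simp only [exponent_eq]
    exact (integrable_fTwo k Φ₂ ξ hξ).integrableOn
  · obtain ⟨Φ₂, h⟩ := transfer (E := EuclideanSpace ℝ (Fin (k + 1))) (E' := ℝ) 0 k
      (by simp; ring)
      (SchwartzMap.compCLMOfContinuousLinearEquiv ℂ (coordC (k + 1)).symm Φ)
    refine ⟨Φ₂, fun g hg hc => ?_⟩
    rw [integral_hTwoR k Φ₂ g hg hc, ← final_uniq _ _ _ _ h g hg hc, ← integral_coord]
    refine integral_congr_ae (Eventually.of_forall fun x => ?_)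
    simp [splitQR_eq]
  · obtain ⟨Ψ, h⟩ := transfer (E := ℝ) (E' := EuclideanSpace ℝ (Fin (k + 1))) k 0
      (by simp; ring) Φ₂
    refine ⟨SchwartzMap.compCLMOfContinuousLinearEquiv ℂ (coordC (k + 1)) Ψ, fun g hg hc => ?_⟩
    rw [integral_hTwoR k Φ₂ g hg hc, final_uniq _ _ _ _ h g hg hc, ← integral_coord]
    refine integral_congr_ae (Eventually.of_forall fun x => ?_)
    simp [splitQR_eq]
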